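/- arXiv:2501.07966 — 2 statements merged into one kernel-verified Lean document; each statement's English description precedes it below -/
import Mathlib

section
/- Let x be the horizontal component of the Peano curve. Let p = p'/q' where p' and q' are positive integers not divisible by 3, and let r = θ·p where θ ∈ ℝ is not an integer multiple of 3^m/p' for any m ∈ ℤ (for example, r irrational). Then for every t ∈ [0,1], lim_{n→∞} [x]_t^{3^{-n}p, 3^{-n}r} = 3^{⌊-log₃ p⌋} · p · (1 - (3/4)·3^{⌊-log₃ p⌋}·p) · t. -/
open scoped BigOperators Classical
open Filter

noncomputable section

/-- The digit map `k n = 2 - n` on `{0,1,2}` (with truncated natural subtraction). -/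
def peanoK : ℕ → ℕ := fun n => 2 - n

/-- The `m`-th (0-indexed) ternary digit of the horizontal component of the Peano curve
evaluated at the point with ternary digits `d` (0-indexed, i.e. `t_j = d (j-1)`):
the `j`-th digit of `x(t)` is `k^[t_2 + t_4 + ⋯ + t_{2j-2}] (t_{2j-1})`. -/
def peanoXDigit (d : ℕ → Fin 3) (m : ℕ) : ℕ :=
  peanoK^[∑ i ∈ Finset.range m, (d (2 * i + 1) : ℕ)] (d (2 * m) : ℕ)

/-- `x : ℝ → ℝ` is (on `[0,1]`) the horizontal component of the Peano curve:
for every ternary expansion `t = Σ_j d_j 3^{-(j+1)}`, `x t` is given by the digit formula. -/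
def IsPeanoX (x : ℝ → ℝ) : Prop :=
  ∀ d : ℕ → Fin 3,
    x (∑' j : ℕ, (d j : ℝ) / 3 ^ (j + 1)) = ∑' m : ℕ, (peanoXDigit d m : ℝ) / 3 ^ (m + 1)

/-- The grid `cℤ + r = {cq + r : q ∈ ℤ}`. -/
def peanoGrid (c r : ℝ) : Set ℝ := {u : ℝ | ∃ q : ℤ, u = c * q + r}

/-- `lebTime x c r m` is the time `t_{m+1}(c,r)` of the Lebesgue partition `π(c,r)` for `x`
on `[0,1]` (values in `[0,1] ∪ {+∞}`, modelled in `EReal`; `sInf ∅ = ⊤ = +∞`). -/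
def lebTime (x : ℝ → ℝ) (c r : ℝ) : ℕ → EReal
  | 0 => sInf (Real.toEReal '' {t : ℝ | t ∈ Set.Icc (0 : ℝ) 1 ∧ x t ∈ peanoGrid c r})
  | m + 1 =>
    if lebTime x c r m = ⊤ then ⊤
    else
      sInf (Real.toEReal ''
        {t : ℝ | t ∈ Set.Icc ((lebTime x c r m).toReal) 1 ∧ x t ∈ peanoGrid c r ∧
          x t ≠ x ((lebTime x c r m).toReal)})

/-- `k(c,r,t) = min{m ∈ ℕ₊ : t_m(c,r) ≥ t}` (recall `t_m(c,r) = lebTime x c r (m-1)`). -/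
def kIdx (x : ℝ → ℝ) (c r t : ℝ) : ℕ :=
  sInf {m : ℕ | 1 ≤ m ∧ (t : EReal) ≤ lebTime x c r (m - 1)}

/-- `l(c,r,t) = max{m ∈ ℕ₊ : t_m(c,r) ≤ t}`. -/
def lIdx (x : ℝ → ℝ) (c r t : ℝ) : ℕ :=
  sSup {m : ℕ | 1 ≤ m ∧ lebTime x c r (m - 1) ≤ (t : EReal)}

/-- The quadratic variation `[x]_{s,t}^{c,r}` of `x` on `[s,t]` along the Lebesgue partition
`π(c,r)`: the sum over `m = k(c,r,s), …, l(c,r,t) - 1` of `(x(t_{m+1}) - x(t_m))²`. -/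
def qvar (x : ℝ → ℝ) (c r s t : ℝ) : ℝ :=
  ∑ m ∈ Finset.Ico (kIdx x c r s) (lIdx x c r t),
    (x ((lebTime x c r m).toReal) - x ((lebTime x c r (m - 1)).toReal)) ^ 2

/-- `[x]_t^{c,r} := [x]_{0,t}^{c,r}`. -/
def qvar0 (x : ℝ → ℝ) (c r t : ℝ) : ℝ := qvar x c r 0 t

lemma peanoXDigit_lt (d : ℕ → Fin 3) (m : ℕ) : peanoXDigit d m < 3 := by
  unfold peanoXDigit
  cases (∑ i ∈ Finset.range m, (d (2 * i + 1) : ℕ)) with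
  | zero => simp
  | succ s =>
    rw [Function.iterate_succ_apply']
    unfold peanoK
    omega

lemma tsum_div_pow_eq_ofDigits (d : ℕ → Fin 3) :
    ∑' j : ℕ, (d j : ℝ) / 3 ^ (j + 1) = Real.ofDigits d := by
  simp [Real.ofDigits, Real.ofDigitsTerm, div_eq_mul_inv]

lemma IsPeanoX.apply_ofDigits {x : ℝ → ℝ} (hx : IsPeanoX x) (d : ℕ → Fin 3) :
    x (Real.ofDigits d) = Real.ofDigits fun m => (⟨peanoXDigit d m, peanoXDigit_lt d m⟩ : Fin 3) := by
  rw [← tsum_div_pow_eq_ofDigits, ← tsum_div_pow_eq_ofDigits, hx d]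

/-- Prepend two ternary digits. -/
def prependTwo (a b : Fin 3) (d : ℕ → Fin 3) : ℕ → Fin 3
  | 0 => a
  | 1 => b
  | n + 2 => d n

lemma peanoK_iterate_add (s b ξ : ℕ) (hb : b < 3) (h : peanoK^[s] ξ < 3) :
    peanoK^[s + b] ξ = if b = 1 then 2 - peanoK^[s] ξ else peanoK^[s] ξ := by
  rw [add_comm, Function.iterate_add_apply]
  generalize peanoK^[s] ξ = y at *
  interval_cases b
  · simp
  · simp [peanoK]
  · simp [peanoK]; omega

lemma peanoXDigit_prependTwo_succ (a b : Fin 3) (d : ℕ → Fin 3) (m : ℕ) :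
    peanoXDigit (prependTwo a b d) (m + 1) =
      if b = 1 then 2 - peanoXDigit d m else peanoXDigit d m := by
  have h := peanoXDigit_lt d m
  unfold peanoXDigit at h ⊢
  rw [Finset.sum_range_succ']
  have h1 : ∀ i, prependTwo a b d (2 * (i + 1) + 1) = d (2 * i + 1) := fun i => rfl
  have h2 : prependTwo a b d (2 * (m + 1)) = d (2 * m) := rfl
  have h3 : prependTwo a b d (2 * 0 + 1) = b := rfl
  simp only [h1, h2, h3]
  rw [peanoK_iterate_add _ _ _ b.isLt h]
  simp [Fin.ext_iff]

lemma ofDigits_two_sub (d : ℕ → Fin 3) :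
    Real.ofDigits (fun m => 2 - d m) = 1 - Real.ofDigits d := by
  have h : Real.ofDigits (fun _ => (2 : Fin 3)) = 1 := Real.ofDigits_const_last_eq_one 2
  rw [← h]
  unfold Real.ofDigits
  rw [← Summable.tsum_sub Real.summable_ofDigitsTerm Real.summable_ofDigitsTerm]
  congr 1
  ext m
  unfold Real.ofDigitsTerm
  have : (((2 - d m : Fin 3) : ℕ) : ℝ) = 2 - (d m : ℕ) := by
    generalize d m = e
    fin_cases e <;> norm_num
    all_goals rfl
  rw [this]
  simp
  ring

lemma ofDigits_succ (d : ℕ → Fin 3) :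
    Real.ofDigits d = ((d 0 : ℕ) + Real.ofDigits fun m => d (m + 1)) / 3 := by
  rw [Real.ofDigits_eq_sum_add_ofDigits d 1]
  simp [Real.ofDigitsTerm]
  ring

lemma IsPeanoX.apply_ninth {x : ℝ → ℝ} (hx : IsPeanoX x) (a b : Fin 3) {u : ℝ}
    (hu : u ∈ Set.Icc (0 : ℝ) 1) :
    x ((3 * (a : ℕ) + (b : ℕ) + u) / 9) = ((a : ℕ) + if b = 1 then 1 - x u else x u) / 3 := by
  obtain ⟨d, -, rfl⟩ := Real.ofDigits_SurjOn (b := 3) (by norm_num) hu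
  have h1 : (3 * ((a : ℕ) : ℝ) + (b : ℕ) + Real.ofDigits d) / 9 =
      Real.ofDigits (prependTwo a b d) := by
    rw [ofDigits_succ (prependTwo a b d), ofDigits_succ (fun m => prependTwo a b d (m + 1))]
    simp only [prependTwo]
    ring
  rw [h1, hx.apply_ofDigits, hx.apply_ofDigits, ofDigits_succ]
  congr 2
  simp only [peanoXDigit_prependTwo_succ]
  split_ifs with hb
  · rw [← ofDigits_two_sub]
    congr 1
    ext m
    have key : ∀ (n : ℕ) (h : n < 3) (h' : 2 - n < 3),
        ((⟨2 - n, h'⟩ : Fin 3) : ℕ) = ((2 - ⟨n, h⟩ : Fin 3) : ℕ) := by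
      intro n h h'
      interval_cases n <;> rfl
    exact key _ (peanoXDigit_lt d m) _
  · rfl

lemma IsPeanoX.mem_Icc {x : ℝ → ℝ} (hx : IsPeanoX x) {u : ℝ}
    (hu : u ∈ Set.Icc (0 : ℝ) 1) : x u ∈ Set.Icc (0 : ℝ) 1 := by
  obtain ⟨d, -, rfl⟩ := Real.ofDigits_SurjOn (b := 3) (by norm_num) hu
  rw [hx.apply_ofDigits]
  exact ⟨Real.ofDigits_nonneg _, Real.ofDigits_le_one _⟩

lemma IsPeanoX.apply_zero {x : ℝ → ℝ} (hx : IsPeanoX x) : x 0 = 0 := by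
  have := hx.apply_ninth 0 0 (u := 0) (by simp)
  simp at this
  linarith

lemma IsPeanoX.apply_one {x : ℝ → ℝ} (hx : IsPeanoX x) : x 1 = 1 := by
  have := hx.apply_ninth 2 2 (u := 1) (by simp)
  rw [if_neg (by decide)] at this
  norm_num at this
  linarith

/-- On `[j/3, (j+1)/3]` the path stays in `[j/3, (j+1)/3]`. -/
lemma IsPeanoX.mem_third {x : ℝ → ℝ} (hx : IsPeanoX x) (j : Fin 3) {u : ℝ}
    (hu : u ∈ Set.Icc ((j : ℕ) / 3 : ℝ) (((j : ℕ) + 1) / 3)) :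
    x u ∈ Set.Icc ((j : ℕ) / 3 : ℝ) (((j : ℕ) + 1) / 3) := by
  obtain ⟨b, w, hw, hb⟩ : ∃ b : Fin 3, ∃ w ∈ Set.Icc (0 : ℝ) 1,
      u = (3 * (j : ℕ) + (b : ℕ) + w) / 9 := by
    obtain ⟨h1, h2⟩ := hu
    rcases le_total (9 * u - 3 * (j : ℕ)) 1 with h | h
    · exact ⟨0, 9 * u - 3 * (j : ℕ), ⟨by linarith, h⟩, by simp⟩
    rcases le_total (9 * u - 3 * (j : ℕ)) 2 with h' | h'
    · exact ⟨1, 9 * u - 3 * (j : ℕ) - 1, ⟨by linarith, by linarith⟩, by simp⟩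
    · exact ⟨2, 9 * u - 3 * (j : ℕ) - 2, ⟨by linarith, by linarith⟩, by simp⟩
  rw [hb, hx.apply_ninth j b hw]
  obtain ⟨h1, h2⟩ := hx.mem_Icc hw
  split_ifs <;> constructor <;> linarith

lemma IsPeanoX.apply_third {x : ℝ → ℝ} (hx : IsPeanoX x) {j : ℕ} (hj : j ≤ 3) :
    x ((j : ℝ) / 3) = (j : ℝ) / 3 := by
  obtain rfl | hj := hj.eq_or_lt
  · simp [hx.apply_one]
  · have := hx.apply_ninth ⟨j, hj⟩ 0 (u := 0) (by simp)
    simp [hx.apply_zero] at this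
    rwa [show (3 * (j : ℝ) / 9) = j / 3 by ring] at this

/-- The direction of the `k`-th unit step of the rescaled path. -/
def peanoSgn (k : ℕ) : ℤ :=
  if k = 0 then 1 else peanoSgn (k / 9) * if k % 3 = 1 then -1 else 1

/-- The position of the rescaled path `s ↦ 3 ^ n * x (s / 9 ^ n)` at the integer time `k`. -/
def peanoPos (k : ℕ) : ℤ :=
  if k = 0 then 0 else
    3 * peanoPos (k / 9) + peanoSgn (k / 9) * ((k % 9 / 3 : ℕ) + if k % 3 = 1 then 1 else 0)

lemma peanoSgn_zero : peanoSgn 0 = 1 := by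
  rw [peanoSgn]; simp

lemma peanoPos_zero : peanoPos 0 = 0 := by
  rw [peanoPos]; simp

lemma peanoSgn_nine_mul_add (i d : ℕ) (hd : d < 9) :
    peanoSgn (9 * i + d) = peanoSgn i * if d % 3 = 1 then -1 else 1 := by
  rw [peanoSgn]
  have h1 : (9 * i + d) / 9 = i := by omega
  have h2 : (9 * i + d) % 3 = d % 3 := by omega
  rw [h1, h2]
  split_ifs with h h'
  · omega
  · obtain ⟨rfl, rfl⟩ : i = 0 ∧ d = 0 := by omega
    simp [peanoSgn_zero]
  all_goals rfl

lemma peanoPos_nine_mul_add (i d : ℕ) (hd : d < 9) :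
    peanoPos (9 * i + d) =
      3 * peanoPos i + peanoSgn i * ((d / 3 : ℕ) + if d % 3 = 1 then 1 else 0) := by
  rw [peanoPos]
  have h1 : (9 * i + d) / 9 = i := by omega
  have h2 : (9 * i + d) % 3 = d % 3 := by omega
  have h3 : (9 * i + d) % 9 = d := by omega
  rw [h1, h2, h3]
  split_ifs with h h'
  · omega
  · obtain ⟨rfl, rfl⟩ : i = 0 ∧ d = 0 := by omega
    simp [peanoPos_zero]
  all_goals rfl

lemma peanoSgn_eq (k : ℕ) : peanoSgn k = 1 ∨ peanoSgn k = -1 := by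
  induction k using Nat.strong_induction_on with
  | _ k ih =>
    rw [peanoSgn]
    split_ifs with h h'
    · simp
    · rcases ih (k / 9) (by omega) with h | h <;> simp [h]
    · rcases ih (k / 9) (by omega) with h | h <;> simp [h]

lemma peanoPos_succ (k : ℕ) : peanoPos (k + 1) = peanoPos k + peanoSgn k := by
  induction k using Nat.strong_induction_on with
  | _ k ih =>
    obtain ⟨i, d, hd, rfl⟩ : ∃ i d, d < 9 ∧ k = 9 * i + d :=
      ⟨k / 9, k % 9, by omega, by omega⟩
    rcases Nat.lt_or_ge d 8 with h | h
    · rw [add_assoc, peanoPos_nine_mul_add i (d + 1) (by omega), peanoPos_nine_mul_add i d hd,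
        peanoSgn_nine_mul_add i d hd]
      interval_cases d <;> norm_num <;> ring
    · obtain rfl : d = 8 := by omega
      have e : 9 * i + 8 + 1 = 9 * (i + 1) + 0 := by ring
      rw [e, peanoPos_nine_mul_add (i + 1) 0 (by omega), ih i (by omega),
        peanoPos_nine_mul_add i 8 (by omega), peanoSgn_nine_mul_add i 8 (by omega)]
      norm_num
      ring

/-- Self-similarity: on `[k / 9 ^ n, (k + 1) / 9 ^ n]` the path is an affine copy of itself. -/
lemma IsPeanoX.apply_scaled {x : ℝ → ℝ} (hx : IsPeanoX x) (n k : ℕ) (hk : k < 9 ^ n) {u : ℝ}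
    (hu : u ∈ Set.Icc (0 : ℝ) 1) :
    x ((k + u) / 9 ^ n) =
      (peanoPos k + if peanoSgn k = 1 then x u else - x u) / 3 ^ n := by
  induction n generalizing k u with
  | zero =>
    obtain rfl : k = 0 := by simpa using hk
    simp [peanoPos_zero, peanoSgn_zero]
  | succ n ih =>
    obtain ⟨i, a, b, rfl⟩ : ∃ i : ℕ, ∃ a b : Fin 3, k = 9 * i + (3 * a + b) :=
      ⟨k / 9, ⟨k % 9 / 3, by omega⟩, ⟨k % 3, by omega⟩, by simp; omega⟩
    have hi : i < 9 ^ n := by rw [pow_succ] at hk; omega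
    have hw : ((3 * (a : ℕ) + (b : ℕ) + u) / 9 : ℝ) ∈ Set.Icc (0 : ℝ) 1 := by
      have ha : ((a : ℕ) : ℝ) ≤ 2 := by exact_mod_cast Nat.le_of_lt_succ a.isLt
      have hb : ((b : ℕ) : ℝ) ≤ 2 := by exact_mod_cast Nat.le_of_lt_succ b.isLt
      obtain ⟨h1, h2⟩ := hu
      constructor
      · positivity
      · linarith
    have e : (((9 * i + (3 * (a : ℕ) + (b : ℕ)) : ℕ) : ℝ) + u) / 9 ^ (n + 1) =
        (i + (3 * (a : ℕ) + (b : ℕ) + u) / 9) / 9 ^ n := by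
      push_cast
      field_simp
      ring
    rw [e, ih i hi hw, hx.apply_ninth a b hu, peanoPos_nine_mul_add i _ (by omega),
      peanoSgn_nine_mul_add i _ (by omega)]
    have h3 : (3 * (a : ℕ) + (b : ℕ)) / 3 = a := by omega
    have h4 : (3 * (a : ℕ) + (b : ℕ)) % 3 = b := by omega
    have h5 : (b = 1) ↔ ((b : ℕ) = 1) := by simp [Fin.ext_iff]
    simp only [h3, h4, h5]
    rcases peanoSgn_eq i with h | h <;> by_cases hb : (b : ℕ) = 1 <;>
      simp [h, hb] <;> field_simp <;> ring

lemma sum_range_nine_mul {M : Type*} [AddCommMonoid M] (f : ℕ → M) (K : ℕ) :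
    ∑ k ∈ Finset.range (9 * K), f k =
      ∑ i ∈ Finset.range K, ∑ d ∈ Finset.range 9, f (9 * i + d) := by
  induction K with
  | zero => simp
  | succ K ih => rw [mul_add, mul_one, Finset.sum_range_add, ih, Finset.sum_range_succ _ K]

/-- The variation of a function of the position along the first `K` unit steps. -/
def posVar (f : ℤ → ℤ) (K : ℕ) : ℤ :=
  ∑ k ∈ Finset.range K, |f (peanoPos (k + 1)) - f (peanoPos k)|

lemma posVar_nine_mul {f : ℤ → ℤ} (hf : Monotone f) (K : ℕ) :
    posVar f (9 * K) = 3 * posVar (fun z => f (3 * z)) K := by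
  unfold posVar
  rw [sum_range_nine_mul, Finset.mul_sum]
  refine Finset.sum_congr rfl fun i _ => ?_
  rw [peanoPos_succ i]
  have step : ∀ d, d < 9 → |f (peanoPos (9 * i + d + 1)) - f (peanoPos (9 * i + d))| =
      f (3 * peanoPos i + peanoSgn i * (d / 3 : ℕ) + if peanoSgn i = 1 then 1 else 0) -
      f (3 * peanoPos i + peanoSgn i * (d / 3 : ℕ) + if peanoSgn i = 1 then 0 else - 1) := by
    intro d hd
    rw [peanoPos_succ, peanoPos_nine_mul_add i d hd, peanoSgn_nine_mul_add i d hd]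
    have m1 : ∀ a, f a ≤ f (a + 1) := fun a => hf (by omega)
    have m2 : ∀ a, f (a + -1) ≤ f a := fun a => hf (by omega)
    rcases peanoSgn_eq i with h | h <;> by_cases hb : d % 3 = 1 <;> simp [h, hb]
    · rw [← add_assoc, add_neg_cancel_right, abs_sub_comm, abs_of_nonneg (sub_nonneg.2 (m1 _))]
    · exact m1 _
    · rw [show 3 * peanoPos i + (-1 + -((d : ℤ) / 3)) + 1 = 3 * peanoPos i + -((d : ℤ) / 3) by ring,
        show 3 * peanoPos i + (-1 + -((d : ℤ) / 3)) = 3 * peanoPos i + -((d : ℤ) / 3) + -1 by ring]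
      exact abs_of_nonneg (sub_nonneg.2 (m2 _))
    · rw [abs_sub_comm]
      exact abs_of_nonneg (sub_nonneg.2 (m2 _))
  rw [Finset.sum_congr rfl fun d hd => step d (Finset.mem_range.1 hd)]
  simp only [Finset.sum_range_succ, Finset.sum_range_zero]
  rcases peanoSgn_eq i with h | h
  · have := hf (show 3 * peanoPos i ≤ 3 * (peanoPos i + 1) by omega)
    rw [h, abs_of_nonneg (sub_nonneg.2 this)]
    norm_num [mul_add, add_assoc]
    ring
  · have := hf (show 3 * (peanoPos i + -1) ≤ 3 * peanoPos i by omega)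
    rw [h, abs_sub_comm, abs_of_nonneg (sub_nonneg.2 this)]
    norm_num [mul_add, add_assoc]
    ring

lemma posVar_pow_mul {f : ℤ → ℤ} (hf : Monotone f) (j K : ℕ) :
    posVar f (9 ^ j * K) = 3 ^ j * posVar (fun z => f (3 ^ j * z)) K := by
  induction j generalizing f with
  | zero => simp
  | succ j ih =>
    rw [pow_succ', mul_assoc, posVar_nine_mul hf,
      ih (f := fun z => f (3 * z)) (fun a b h => hf (by omega))]
    simp only [← mul_assoc, ← pow_succ']

/-- Indicates whether the rescaled path turns around at the integer time `k`. -/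
def peanoTurn (k : ℕ) : ℤ := if peanoSgn (k - 1) = peanoSgn k then 0 else 1

/-- The number of turns among the first `K` integer times. -/
def turnCount (K : ℕ) : ℤ := ∑ k ∈ Finset.range K, peanoTurn k

lemma peanoTurn_nine_mul (i : ℕ) : peanoTurn (9 * i) = peanoTurn i := by
  unfold peanoTurn
  rcases i with _ | i
  · rfl
  · rw [show 9 * (i + 1) - 1 = 9 * i + 8 by omega, show 9 * (i + 1) = 9 * (i + 1) + 0 by ring,
      peanoSgn_nine_mul_add _ _ (by omega), peanoSgn_nine_mul_add _ _ (by omega)]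
    simp

lemma turnCount_nine_mul (K : ℕ) : turnCount (9 * K) = 6 * K + turnCount K := by
  unfold turnCount
  rw [sum_range_nine_mul]
  have : ∀ i, ∑ d ∈ Finset.range 9, peanoTurn (9 * i + d) = 6 + peanoTurn i := by
    intro i
    have step : ∀ d, d < 8 → peanoTurn (9 * i + (d + 1)) = if d % 3 = 2 then 0 else 1 := by
      intro d hd
      unfold peanoTurn
      rw [show 9 * i + (d + 1) - 1 = 9 * i + d by omega, peanoSgn_nine_mul_add _ _ (by omega),
        peanoSgn_nine_mul_add _ _ (by omega)]
      rcases peanoSgn_eq i with h | h <;> rw [h] <;> interval_cases d <;> norm_num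
    rw [Finset.sum_range_succ', Finset.sum_congr rfl fun d hd => step d (Finset.mem_range.1 hd),
      add_zero, peanoTurn_nine_mul]
    congr 1
  simp only [this, Finset.sum_add_distrib, Finset.sum_const, Finset.card_range]
  simp [mul_comm]

lemma turnCount_pow_mul (j K : ℕ) :
    4 * turnCount (9 ^ j * K) = 3 * (9 ^ j - 1) * K + 4 * turnCount K := by
  induction j with
  | zero => simp
  | succ j ih =>
    rw [pow_succ', mul_assoc, turnCount_nine_mul]
    push_cast
    rw [pow_succ']
    linarith

/-- A sequence whose increments over `9`-adic blocks are of square root order is of square root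
order. -/
lemma abs_le_of_block_le (E : ℕ → ℝ) (C : ℝ) (h0 : E 0 = 0)
    (h : ∀ j i, |E (9 ^ j * (i + 1)) - E (9 ^ j * i)| ≤ C * 3 ^ j) (n K : ℕ) (hK : K ≤ 9 ^ n) :
    |E K| ≤ 12 * C * 3 ^ n := by
  have hC : 0 ≤ C := by simpa using (abs_nonneg _).trans (h 0 0)
  have run : ∀ j i d : ℕ, |E (9 ^ j * (i + d)) - E (9 ^ j * i)| ≤ d * (C * 3 ^ j) := by
    intro j i d
    induction d with
    | zero => simp
    | succ d ih =>
      have := h j (i + d)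
      have := abs_sub_le (E (9 ^ j * (i + (d + 1)))) (E (9 ^ j * (i + d))) (E (9 ^ j * i))
      push_cast
      rw [← add_assoc] at *
      linarith
  have key : ∀ n : ℕ, |E K - E (9 ^ n * (K / 9 ^ n))| ≤ 4 * C * (3 ^ n - 1) := by
    intro n
    induction n with
    | zero => simp
    | succ n ih =>
      have h1 := run n (9 * (K / 9 ^ (n + 1))) (K / 9 ^ n % 9)
      have h2 : 9 * (K / 9 ^ (n + 1)) + K / 9 ^ n % 9 = K / 9 ^ n := by
        rw [pow_succ, ← Nat.div_div_eq_div_mul]; omega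
      rw [h2, ← mul_assoc, ← pow_succ] at h1
      have h3 := abs_sub_le (E K) (E (9 ^ n * (K / 9 ^ n))) (E (9 ^ (n + 1) * (K / 9 ^ (n + 1))))
      have h4 : ((K / 9 ^ n % 9 : ℕ) : ℝ) ≤ 8 := by
        exact_mod_cast Nat.le_of_lt_succ (Nat.mod_lt _ (by norm_num))
      have h5 : ((K / 9 ^ n % 9 : ℕ) : ℝ) * (C * 3 ^ n) ≤ 8 * (C * 3 ^ n) :=
        mul_le_mul_of_nonneg_right h4 (by positivity)
      rw [pow_succ (3 : ℝ)]
      linarith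
  have := key (n + 1)
  rw [Nat.div_eq_of_lt (by rw [pow_succ]; have := Nat.pow_pos (n := n) (show 0 < 9 by norm_num); omega),
    mul_zero, h0, sub_zero, pow_succ] at this
  linarith

/-- The times in `[e, 1]` at which `x` visits a grid point other than the one with index `s`. -/
def hitSet (x : ℝ → ℝ) (c r e : ℝ) (s : ℤ) : Set ℝ :=
  {t : ℝ | t ∈ Set.Icc e 1 ∧ x t ∈ peanoGrid c r ∧ x t ≠ c * s + r}

lemma isCompact_hitSet {x : ℝ → ℝ} (hx : ContinuousOn x (Set.Icc 0 1)) {c : ℝ} (hc : 0 < c)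
    (r : ℝ) {e : ℝ} (he : 0 ≤ e) (s : ℤ) : IsCompact (hitSet x c r e s) := by
  have hcl : IsClosed ((fun q : ℤ => c * q + r) '' {q | q ≠ s}) := by
    have h1 : IsClosed (((↑) : ℤ → ℝ) '' {q | q ≠ s}) :=
      Int.isClosedEmbedding_coe_real.isClosedMap _ (isClosed_discrete _)
    have h2 := ((Homeomorph.mulLeft₀ c hc.ne').trans (Homeomorph.addRight r)).isClosedMap _ h1
    rwa [Set.image_image] at h2
  have hco := (hx.mono (Set.Icc_subset_Icc_left he)).preimage_isClosed_of_isClosed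
    (isClosed_Icc (a := e) (b := 1)) hcl
  refine (isCompact_Icc (a := e) (b := 1)).of_isClosed_subset ?_ (fun t ht => ht.1)
  convert hco using 1
  ext t
  refine and_congr_right fun _ => ⟨?_, ?_⟩
  · rintro ⟨⟨q, hq⟩, hs⟩
    exact ⟨q, fun h => hs (by rw [hq, h]), hq.symm⟩
  · rintro ⟨q, hq, hqt⟩
    refine ⟨⟨q, hqt.symm⟩, fun h => hq ?_⟩
    have : c * (q : ℝ) = c * s := by
      have := hqt.trans h
      simpa using this
    exact_mod_cast mul_left_cancel₀ hc.ne' this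

lemma exists_isLeast_sInf_image {S : Set ℝ} (hS : IsCompact S) (hne : S.Nonempty) :
    ∃ m, IsLeast S m ∧ sInf (Real.toEReal '' S) = m := by
  obtain ⟨m, hm⟩ := hS.exists_isLeast hne
  exact ⟨m, hm, ((EReal.coe_strictMono.monotone.map_isLeast hm).isGLB).sInf_eq⟩

lemma lt_sInf_image {S : Set ℝ} (hS : IsCompact S) {b : ℝ} (h : ∀ t ∈ S, b < t) :
    (b : EReal) < sInf (Real.toEReal '' S) := by
  rcases S.eq_empty_or_nonempty with rfl | hne
  · simp
  · obtain ⟨m, hm, e⟩ := exists_isLeast_sInf_image hS hne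
    rw [e]
    exact_mod_cast h m hm.1

/-- By time `a`, exactly `N` times of the Lebesgue partition have occurred, and the grid point
visited last has index `s` (for `N = 0`, the index `s` is one that is never visited). -/
structure HitState (x : ℝ → ℝ) (c r a : ℝ) (N : ℕ) (s : ℤ) : Prop where
  next : ∃ e, 0 ≤ e ∧ e ≤ a ∧ lebTime x c r N = sInf (Real.toEReal '' hitSet x c r e s)
  lt : (a : EReal) < lebTime x c r N
  last : ∀ m, N = m + 1 → lebTime x c r m ≤ a ∧ x (lebTime x c r m).toReal = c * s + r
  steps : ∀ m ∈ Finset.Ico 1 N,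
    (x ((lebTime x c r m).toReal) - x ((lebTime x c r (m - 1)).toReal)) ^ 2 = c ^ 2

lemma HitState.lt_of_mem {x : ℝ → ℝ} {c r a : ℝ} {N : ℕ} {s : ℤ} (h : HitState x c r a N s)
    {e : ℝ} (he : lebTime x c r N = sInf (Real.toEReal '' hitSet x c r e s)) {t : ℝ}
    (ht : t ∈ hitSet x c r e s) : a < t := by
  have h1 : lebTime x c r N ≤ t := by
    rw [he]
    exact sInf_le ⟨t, ht, rfl⟩
  exact_mod_cast h.lt.trans_le h1

lemma HitState.stay {x : ℝ → ℝ} (hx : ContinuousOn x (Set.Icc 0 1)) {c r a b : ℝ} (hc : 0 < c)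
    {N : ℕ} {s : ℤ} (h : HitState x c r a N s) (hab : a ≤ b)
    (hno : ∀ t ∈ Set.Icc a b, x t ∈ peanoGrid c r → x t = c * s + r) :
    HitState x c r b N s := by
  obtain ⟨e, he0, hea, he⟩ := h.next
  refine ⟨⟨e, he0, hea.trans hab, he⟩, ?_, fun m hm => ?_, h.steps⟩
  · rw [he]
    refine lt_sInf_image (isCompact_hitSet hx hc r he0 s) fun t ht => ?_
    by_contra! hb
    exact ht.2.2 (hno t ⟨(h.lt_of_mem he ht).le, hb⟩ ht.2.1)
  · exact ⟨(h.last m hm).1.trans (by exact_mod_cast hab), (h.last m hm).2⟩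

lemma HitState.move {x : ℝ → ℝ} (hx : ContinuousOn x (Set.Icc 0 1)) {c r a b : ℝ} (hc : 0 < c)
    {N : ℕ} {s s' : ℤ} (h : HitState x c r a N s) (hb : b ≤ 1) (hs : |s' - s| = 1)
    (hhit : ∃ t ∈ Set.Icc a b, x t = c * s' + r)
    (honly : ∀ t ∈ Set.Icc a b, x t ∈ peanoGrid c r → x t = c * s' + r) :
    HitState x c r b (N + 1) s' := by
  obtain ⟨e, he0, hea, he⟩ := h.next
  have hne : ∀ y, y = c * s' + r → y ≠ c * s + r := by
    rintro y rfl hy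
    have : (s' : ℝ) = s := by
      rw [add_left_inj] at hy
      exact mul_left_cancel₀ hc.ne' hy
    have : s' = s := by exact_mod_cast this
    simp [this] at hs
  obtain ⟨τ, hτ, hxτ⟩ := hhit
  have hτS : τ ∈ hitSet x c r e s :=
    ⟨⟨hea.trans hτ.1, hτ.2.trans hb⟩, ⟨s', hxτ⟩, hne _ hxτ⟩
  obtain ⟨m, hm, hmeq⟩ :=
    exists_isLeast_sInf_image (isCompact_hitSet hx hc r he0 s) ⟨τ, hτS⟩
  rw [← he] at hmeq
  have ham : a < m := h.lt_of_mem he hm.1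
  have hmb : m ≤ b := (hm.2 hτS).trans hτ.2
  have hxm : x m = c * s' + r := honly m ⟨ham.le, hmb⟩ hm.1.2.1
  have hm0 : 0 ≤ m := he0.trans hm.1.1.1
  have hnext : lebTime x c r (N + 1) = sInf (Real.toEReal '' hitSet x c r m s') := by
    rw [lebTime, hmeq, if_neg (EReal.coe_ne_top _), EReal.toReal_coe, hxm]
    rfl
  refine ⟨⟨m, hm0, hmb, hnext⟩, ?_, ?_, ?_⟩
  · rw [hnext]
    refine lt_sInf_image (isCompact_hitSet hx hc r hm0 s') fun t ht => ?_
    by_contra! htb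
    exact ht.2.2 (honly t ⟨ham.le.trans ht.1.1, htb⟩ ht.2.1)
  · intro k hk
    obtain rfl : N = k := by omega
    rw [hmeq]
    exact ⟨by exact_mod_cast hmb, by simpa using hxm⟩
  · intro k hk
    rcases (Nat.lt_succ_iff_lt_or_eq.1 (Finset.mem_Ico.1 hk).2) with hk' | rfl
    · exact h.steps k (Finset.mem_Ico.2 ⟨(Finset.mem_Ico.1 hk).1, hk'⟩)
    · have hk1 := (Finset.mem_Ico.1 hk).1
      rw [hmeq, EReal.toReal_coe, hxm, (h.last (k - 1) (by omega)).2]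
      have : ((s' : ℝ) - s) ^ 2 = 1 := by
        have h2 : |(s' : ℝ) - s| = 1 := by exact_mod_cast hs
        rw [← sq_abs, h2, one_pow]
      linear_combination c ^ 2 * this

lemma lebTime_le_succ (x : ℝ → ℝ) (c r : ℝ) (m : ℕ) :
    0 ≤ lebTime x c r m ∧ lebTime x c r m ≤ lebTime x c r (m + 1) := by
  have step : ∀ m, 0 ≤ lebTime x c r m → lebTime x c r m ≤ lebTime x c r (m + 1) := by
    intro m h0
    rw [lebTime]
    split_ifs with h
    · simp
    · refine le_sInf ?_
      rintro _ ⟨t, ht, rfl⟩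
      rw [← EReal.coe_toReal h (fun hb => by simp [hb] at h0)]
      exact_mod_cast ht.1.1
  have h0 : ∀ m, 0 ≤ lebTime x c r m := by
    intro m
    induction m with
    | zero =>
      refine le_sInf ?_
      rintro _ ⟨t, ht, rfl⟩
      exact_mod_cast ht.1.1
    | succ m ih => exact ih.trans (step m ih)
  exact ⟨h0 m, step m (h0 m)⟩

lemma monotone_lebTime (x : ℝ → ℝ) (c r : ℝ) : Monotone (lebTime x c r) :=
  monotone_nat_of_le_succ fun m => (lebTime_le_succ x c r m).2

lemma kIdx_zero (x : ℝ → ℝ) (c r : ℝ) : kIdx x c r 0 = 1 := by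
  have h1 : 1 ∈ {m : ℕ | 1 ≤ m ∧ ((0 : ℝ) : EReal) ≤ lebTime x c r (m - 1)} :=
    ⟨le_rfl, by simpa using (lebTime_le_succ x c r 0).1⟩
  exact le_antisymm (Nat.sInf_le h1) (Nat.sInf_mem ⟨1, h1⟩).1

lemma HitState.mem_of_lebTime_le {x : ℝ → ℝ} {c r a : ℝ} {N : ℕ} {s : ℤ}
    (h : HitState x c r a N s) {m : ℕ} (hm : lebTime x c r (m - 1) ≤ a) : m ≤ N := by
  by_contra! hN
  exact absurd (h.lt.trans_le (monotone_lebTime x c r (show N ≤ m - 1 by omega))) (not_lt.2 hm)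

/-- Two states enclosing `t` determine the quadratic variation up to time `t`. -/
lemma HitState.exists_qvar0_eq {x : ℝ → ℝ} {c r a b t : ℝ} {N M : ℕ} {s s' : ℤ}
    (h : HitState x c r a N s) (h' : HitState x c r b M s') (hat : a ≤ t) (htb : t ≤ b) :
    ∃ L : ℕ, N ≤ L ∧ L ≤ M ∧ qvar0 x c r t = (L - 1 : ℕ) * c ^ 2 := by
  have hbdd : ∀ m ∈ {m : ℕ | 1 ≤ m ∧ lebTime x c r (m - 1) ≤ (t : EReal)}, m ≤ M := fun m hm =>
    h'.mem_of_lebTime_le (hm.2.trans (by exact_mod_cast htb))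
  have hLM : lIdx x c r t ≤ M := csSup_le' hbdd
  refine ⟨lIdx x c r t, ?_, hLM, ?_⟩
  · rcases N with _ | N
    · exact Nat.zero_le _
    · exact le_csSup ⟨M, hbdd⟩ ⟨by omega, (h.last N rfl).1.trans (by exact_mod_cast hat)⟩
  · unfold qvar0 qvar
    rw [kIdx_zero, Finset.sum_congr rfl fun m hm => h'.steps m ?_]
    · simp
    · simp only [Finset.mem_Ico] at hm ⊢
      omega

lemma IsPeanoX.abs_sub_le_of_mem {x : ℝ → ℝ} (hx : IsPeanoX x) {n k : ℕ} (hk : k < 9 ^ n)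
    {u w : ℝ} (hu : u ∈ Set.Icc ((k : ℝ) / 9 ^ n) ((k + 1) / 9 ^ n))
    (hw : w ∈ Set.Icc ((k : ℝ) / 9 ^ n) ((k + 1) / 9 ^ n)) :
    |x u - x w| ≤ 1 / 3 ^ n := by
  have key : ∀ y ∈ Set.Icc ((k : ℝ) / 9 ^ n) ((k + 1) / 9 ^ n),
      ∃ z ∈ Set.Icc (0 : ℝ) 1,
        x y = (peanoPos k + if peanoSgn k = 1 then z else - z) / 3 ^ n := by
    intro y hy
    have h9 : (0 : ℝ) < 9 ^ n := by positivity
    have hm : y * 9 ^ n - k ∈ Set.Icc (0 : ℝ) 1 := by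
      have h1 := (div_le_iff₀ h9).1 hy.1
      have h2 := (le_div_iff₀ h9).1 hy.2
      constructor <;> linarith
    refine ⟨x (y * 9 ^ n - k), hx.mem_Icc hm, ?_⟩
    rw [← hx.apply_scaled n k hk hm]
    congr 1
    field_simp
    ring
  obtain ⟨z, ⟨hz0, hz1⟩, hz⟩ := key u hu
  obtain ⟨z', ⟨hz0', hz1'⟩, hz'⟩ := key w hw
  rw [hz, hz', ← sub_div, abs_div, abs_of_pos (show (0 : ℝ) < 3 ^ n by positivity)]
  gcongr
  rw [abs_le]
  split_ifs <;> constructor <;> linarith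

lemma exists_nat_mem_Icc_div {t : ℝ} (ht : t ∈ Set.Icc (0 : ℝ) 1) {M : ℕ} (hM : 0 < M) :
    ∃ k : ℕ, k < M ∧ t ∈ Set.Icc ((k : ℝ) / M) ((k + 1) / M) := by
  have hM' : (0 : ℝ) < M := by exact_mod_cast hM
  rcases ht.2.eq_or_lt with rfl | h1
  · refine ⟨M - 1, by omega, ?_⟩
    rw [Nat.cast_sub hM]
    constructor
    · rw [div_le_one hM']; simp
    · rw [le_div_iff₀ hM']; simp
  · have h0 : 0 ≤ t * M := mul_nonneg ht.1 hM'.le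
    refine ⟨⌊t * M⌋₊, ?_, ?_⟩
    · rw [Nat.floor_lt h0]; nlinarith
    · constructor
      · rw [div_le_iff₀ hM']; exact Nat.floor_le h0
      · rw [le_div_iff₀ hM']; exact (Nat.lt_floor_add_one _).le

lemma IsPeanoX.continuousOn {x : ℝ → ℝ} (hx : IsPeanoX x) :
    ContinuousOn x (Set.Icc 0 1) := by
  have key : ∀ n : ℕ, ∀ s ∈ Set.Icc (0 : ℝ) 1, ∀ t ∈ Set.Icc (0 : ℝ) 1, s ≤ t →
      t - s ≤ 1 / 9 ^ n → |x s - x t| ≤ 2 / 3 ^ n := by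
    intro n s hs t ht hst hd
    obtain ⟨k, hk, hkt⟩ := exists_nat_mem_Icc_div ht (M := 9 ^ n) (by positivity)
    push_cast at hkt
    have hkk : (k : ℝ) / 9 ^ n ∈ Set.Icc ((k : ℝ) / 9 ^ n) ((k + 1) / 9 ^ n) :=
      ⟨le_rfl, by gcongr; linarith⟩
    have h3 : (0 : ℝ) < 1 / 3 ^ n := by positivity
    have e3 : (2 : ℝ) / 3 ^ n = 1 / 3 ^ n + 1 / 3 ^ n := by ring
    rcases le_or_gt ((k : ℝ) / 9 ^ n) s with h | h
    · have := hx.abs_sub_le_of_mem hk ⟨h, hst.trans hkt.2⟩ hkt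
      linarith
    · rcases k with _ | k
      · simp at h
        exact absurd hs.1 (not_le.2 h)
      · have h1 := hx.abs_sub_le_of_mem hk hkk hkt
        push_cast at *
        have h2 := hx.abs_sub_le_of_mem (n := n) (k := k) (by omega) (u := s)
          (w := ((k : ℝ) + 1) / 9 ^ n) ⟨?_, h.le⟩ ⟨by gcongr; linarith, le_rfl⟩
        · have := abs_sub_le (x s) (x (((k : ℝ) + 1) / 9 ^ n)) (x t)
          linarith
        · have := hkt.1
          rw [add_div] at this
          linarith
  rw [Metric.continuousOn_iff]
  intro t ht ε hε
  obtain ⟨n, hn⟩ := exists_pow_lt_of_lt_one (show 0 < ε / 2 by positivity)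
    (show (1 / 3 : ℝ) < 1 by norm_num)
  have hn' : (2 : ℝ) / 3 ^ n < ε := by
    rw [one_div_pow] at hn
    rw [div_eq_mul_one_div]
    linarith
  refine ⟨1 / 9 ^ n, by positivity, fun s hs hd => ?_⟩
  rw [Real.dist_eq] at hd ⊢
  refine lt_of_le_of_lt ?_ hn'
  rcases le_total s t with h | h
  · refine key n s hs t ht h ?_
    rw [abs_sub_comm] at hd
    exact (le_abs_self _).trans hd.le
  · rw [abs_sub_comm]
    exact key n t ht s hs h ((le_abs_self _).trans hd.le)

/-- The index of the largest point of the grid `cℤ + r` not exceeding `u`. -/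
def gridIdx (c r u : ℝ) : ℤ := ⌊(u - r) / c⌋

lemma gridIdx_mono {c : ℝ} (hc : 0 < c) (r : ℝ) : Monotone (gridIdx c r) := fun u v h => by
  unfold gridIdx
  gcongr

lemma gridIdx_spec {c r u : ℝ} (hc : 0 < c) :
    c * gridIdx c r u + r ≤ u ∧ u < c * (gridIdx c r u + 1) + r := by
  have h1 := Int.floor_le ((u - r) / c)
  have h2 := Int.lt_floor_add_one ((u - r) / c)
  rw [le_div_iff₀ hc] at h1
  rw [div_lt_iff₀ hc] at h2
  unfold gridIdx
  constructor <;> linarith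

lemma le_gridIdx_iff {c r u : ℝ} (hc : 0 < c) (q : ℤ) :
    q ≤ gridIdx c r u ↔ c * q + r ≤ u := by
  unfold gridIdx
  rw [Int.le_floor, le_div_iff₀ hc, mul_comm c, le_sub_iff_add_le]

lemma gridIdx_div {c r z d : ℝ} (hd : d ≠ 0) :
    gridIdx (c / d) (r / d) (z / d) = gridIdx c r z := by
  unfold gridIdx
  rw [← sub_div, div_div_div_cancel_right₀ hd]

lemma gridIdx_add_le {c r u w : ℝ} (hc : 0 < c) (h : w ≤ u + c) :
    gridIdx c r w ≤ gridIdx c r u + 1 := by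
  unfold gridIdx
  rw [← Int.floor_add_one]
  apply Int.floor_le_floor
  rw [div_add_one hc.ne']
  gcongr
  linarith

lemma le_gridIdx_add {c r u w : ℝ} (hc : 0 < c) (h : u + c ≤ w) :
    gridIdx c r u + 1 ≤ gridIdx c r w := by
  unfold gridIdx
  rw [← Int.floor_add_one]
  apply Int.floor_le_floor
  rw [div_add_one hc.ne']
  gcongr
  linarith

/-- Effect of a monotone-range piece of the path, of height at most `c`, travelled upwards. -/
lemma HitState.up {x : ℝ → ℝ} (hx : ContinuousOn x (Set.Icc 0 1)) {c r a b u w : ℝ}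
    (hc : 0 < c) {N : ℕ} {s : ℤ} (h : HitState x c r a N s) (ha : 0 ≤ a) (hab : a ≤ b)
    (hb : b ≤ 1) (hu : x a = u) (hw : x b = w) (huG : u ∉ peanoGrid c r)
    (hmaps : ∀ t ∈ Set.Icc a b, x t ∈ Set.Icc u w) (hle : w ≤ u + c)
    (hs : s = gridIdx c r u ∨ s = gridIdx c r u + 1) :
    ∃ (N' : ℕ) (s' : ℤ), HitState x c r b N' s' ∧ s' = max s (gridIdx c r w) ∧
      (N' : ℤ) = N + (s' - s) := by
  have huw : u ≤ w := by rw [← hu]; exact (hmaps a ⟨le_rfl, hab⟩).2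
  have hmono := gridIdx_mono hc r huw
  have hle' := gridIdx_add_le (r := r) hc hle
  have hq : ∀ q : ℤ, c * q + r ∈ Set.Icc u w → gridIdx c r u < q ∧ q ≤ gridIdx c r w := by
    rintro q ⟨h1, h2⟩
    refine ⟨?_, (le_gridIdx_iff hc q).2 h2⟩
    by_contra! hle
    exact huG ⟨q, le_antisymm h1 ((le_gridIdx_iff hc q).1 hle)⟩
  by_cases hstay : gridIdx c r w ≤ s
  · refine ⟨N, s, h.stay hx hc hab ?_, by omega, by omega⟩
    rintro t ht ⟨q, hqt⟩
    have := hq q (hqt ▸ hmaps t ht)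
    rw [hqt, show q = s by omega]
  · obtain ⟨hs1, hs2⟩ : s = gridIdx c r u ∧ gridIdx c r w = s + 1 := by omega
    refine ⟨N + 1, gridIdx c r w, h.move hx hc hb (by rw [hs2]; simp) ?_ ?_, by omega, by omega⟩
    · have hxab := hx.mono (Set.Icc_subset_Icc ha hb)
      have hmem : c * (gridIdx c r w : ℝ) + r ∈ Set.Icc (x a) (x b) := by
        rw [hu, hw]
        refine ⟨?_, (gridIdx_spec hc).1⟩
        have := (gridIdx_spec (r := r) (u := u) hc).2
        rw [hs2, hs1]
        push_cast
        linarith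
      obtain ⟨t, ht, e⟩ := intermediate_value_Icc hab hxab hmem
      exact ⟨t, ht, e⟩
    · rintro t ht ⟨q, hqt⟩
      have := hq q (hqt ▸ hmaps t ht)
      rw [hqt, show q = gridIdx c r w by omega]

/-- Effect of a monotone-range piece of the path, of height at most `c`, travelled downwards. -/
lemma HitState.down {x : ℝ → ℝ} (hx : ContinuousOn x (Set.Icc 0 1)) {c r a b u w : ℝ}
    (hc : 0 < c) {N : ℕ} {s : ℤ} (h : HitState x c r a N s) (ha : 0 ≤ a) (hab : a ≤ b)
    (hb : b ≤ 1) (hu : x a = u) (hw : x b = w) (hwG : w ∉ peanoGrid c r)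
    (hmaps : ∀ t ∈ Set.Icc a b, x t ∈ Set.Icc w u) (hle : u ≤ w + c)
    (hs : s = gridIdx c r u ∨ s = gridIdx c r u + 1) :
    ∃ (N' : ℕ) (s' : ℤ), HitState x c r b N' s' ∧ s' = min s (gridIdx c r w + 1) ∧
      (N' : ℤ) = N + (s - s') := by
  have huw : w ≤ u := by rw [← hu]; exact (hmaps a ⟨le_rfl, hab⟩).1
  have hmono := gridIdx_mono hc r huw
  have hle' := gridIdx_add_le (r := r) hc hle
  have hq : ∀ q : ℤ, c * q + r ∈ Set.Icc w u → gridIdx c r w < q ∧ q ≤ gridIdx c r u := by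
    rintro q ⟨h1, h2⟩
    refine ⟨?_, (le_gridIdx_iff hc q).2 h2⟩
    by_contra! hle
    exact hwG ⟨q, le_antisymm h1 ((le_gridIdx_iff hc q).1 hle)⟩
  by_cases hstay : s ≤ gridIdx c r w + 1
  · refine ⟨N, s, h.stay hx hc hab ?_, by omega, by omega⟩
    rintro t ht ⟨q, hqt⟩
    have := hq q (hqt ▸ hmaps t ht)
    rw [hqt, show q = s by omega]
  · obtain ⟨hs1, hs2⟩ : gridIdx c r u = gridIdx c r w + 1 ∧ s = gridIdx c r w + 1 + 1 := by omega
    refine ⟨N + 1, gridIdx c r w + 1, h.move hx hc hb (by rw [hs2]; simp) ?_ ?_,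
      by omega, by omega⟩
    · have hxab := hx.mono (Set.Icc_subset_Icc ha hb)
      have hmem : c * ((gridIdx c r w + 1 : ℤ) : ℝ) + r ∈ Set.Icc (x b) (x a) := by
        rw [hu, hw]
        refine ⟨?_, ?_⟩
        · have := (gridIdx_spec (r := r) (u := w) hc).2
          push_cast
          linarith
        · rw [← hs1]
          exact (gridIdx_spec hc).1
      obtain ⟨t, ht, e⟩ := intermediate_value_Icc' hab hxab hmem
      exact ⟨t, ht, e⟩
    · rintro t ht ⟨q, hqt⟩
      have := hq q (hqt ▸ hmaps t ht)
      rw [hqt, show q = gridIdx c r w + 1 by omega]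

lemma IsPeanoX.apply_scaled_third {x : ℝ → ℝ} (hx : IsPeanoX x) {n k : ℕ} (hk : k < 9 ^ n)
    {j : ℕ} (hj : j ≤ 3) :
    x ((k + (j : ℝ) / 3) / 9 ^ n) =
      (peanoPos k + if peanoSgn k = 1 then (j : ℝ) / 3 else - ((j : ℝ) / 3)) / 3 ^ n := by
  have hj' : (j : ℝ) ≤ 3 := by exact_mod_cast hj
  rw [hx.apply_scaled n k hk ⟨by positivity, by linarith⟩, hx.apply_third hj]

lemma IsPeanoX.mapsTo_scaled_third {x : ℝ → ℝ} (hx : IsPeanoX x) {n k : ℕ} (hk : k < 9 ^ n)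
    {j : ℕ} (hj : j < 3) {t : ℝ}
    (ht : t ∈ Set.Icc ((k + (j : ℝ) / 3) / 9 ^ n) ((k + ((j + 1 : ℕ) : ℝ) / 3) / 9 ^ n)) :
    ∃ z ∈ Set.Icc ((j : ℝ) / 3) (((j + 1 : ℕ) : ℝ) / 3),
      x t = (peanoPos k + if peanoSgn k = 1 then z else - z) / 3 ^ n := by
  have h9 : (0 : ℝ) < 9 ^ n := by positivity
  have hj' : (j : ℝ) ≤ 2 := by exact_mod_cast Nat.le_of_lt_succ hj
  have hj0 : (0 : ℝ) ≤ (j : ℝ) / 3 := by positivity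
  have h1 := (div_le_iff₀ h9).1 ht.1
  have h2 := (le_div_iff₀ h9).1 ht.2
  push_cast at h2 ⊢
  have hm := hx.mem_third ⟨j, hj⟩ (u := t * 9 ^ n - k) ⟨by linarith, by linarith⟩
  refine ⟨x (t * 9 ^ n - k), hm, ?_⟩
  rw [← hx.apply_scaled n k hk ⟨by linarith, by linarith⟩]
  congr 1
  field_simp
  ring

lemma third_notMem_peanoGrid {c r : ℝ} (hG : ∀ z q : ℤ, (z : ℝ) / 3 ≠ c * q + r) (n : ℕ)
    (z : ℤ) : (z : ℝ) / 3 / 3 ^ n ∉ peanoGrid (c / 3 ^ n) (r / 3 ^ n) := by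
  rintro ⟨q, hq⟩
  apply hG z q
  have h3 : (0 : ℝ) < 3 ^ n := by positivity
  field_simp at hq
  linarith

lemma HitState.third_up {x : ℝ → ℝ} (hx : IsPeanoX x) {c r : ℝ} (hc : 1 / 3 ≤ c)
    (hG : ∀ z q : ℤ, (z : ℝ) / 3 ≠ c * q + r) {n k j : ℕ} (hk : k < 9 ^ n) (hj : j < 3)
    (hsgn : peanoSgn k = 1) {N : ℕ} {s : ℤ}
    (h : HitState x (c / 3 ^ n) (r / 3 ^ n) ((k + (j : ℝ) / 3) / 9 ^ n) N s)
    (hs : s = gridIdx c r (peanoPos k + (j : ℝ) / 3) ∨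
      s = gridIdx c r (peanoPos k + (j : ℝ) / 3) + 1) :
    ∃ (N' : ℕ) (s' : ℤ),
      HitState x (c / 3 ^ n) (r / 3 ^ n) ((k + ((j + 1 : ℕ) : ℝ) / 3) / 9 ^ n) N' s' ∧
      s' = max s (gridIdx c r (peanoPos k + ((j + 1 : ℕ) : ℝ) / 3)) ∧
      (N' : ℤ) = N + (s' - s) := by
  have hj' : (j : ℝ) ≤ 2 := by exact_mod_cast Nat.le_of_lt_succ hj
  have hk' : (k : ℝ) + 1 ≤ 9 ^ n := by exact_mod_cast hk
  have h3 : (3 : ℝ) ^ n ≠ 0 := by positivity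
  rw [← gridIdx_div h3] at hs
  rw [← gridIdx_div h3]
  refine h.up hx.continuousOn (by positivity) (by positivity) (by gcongr; simp)
    ?_ ?_ ?_ ?_ ?_ ?_ hs
  · push_cast
    rw [div_le_one (by positivity)]
    linarith
  · rw [hx.apply_scaled_third hk hj.le, if_pos hsgn]
  · rw [hx.apply_scaled_third hk hj, if_pos hsgn]
  · have := third_notMem_peanoGrid hG n (3 * peanoPos k + j)
    push_cast at this
    rwa [add_div, mul_div_cancel_left₀ _ (by norm_num : (3 : ℝ) ≠ 0)] at this
  · intro t ht
    obtain ⟨z, ⟨hz1, hz2⟩, hz⟩ := hx.mapsTo_scaled_third hk hj ht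
    rw [hz, if_pos hsgn]
    constructor <;> gcongr
  · rw [← add_div]
    refine div_le_div_of_nonneg_right ?_ (by positivity)
    push_cast
    linarith

lemma HitState.third_down {x : ℝ → ℝ} (hx : IsPeanoX x) {c r : ℝ} (hc : 1 / 3 ≤ c)
    (hG : ∀ z q : ℤ, (z : ℝ) / 3 ≠ c * q + r) {n k j : ℕ} (hk : k < 9 ^ n) (hj : j < 3)
    (hsgn : peanoSgn k ≠ 1) {N : ℕ} {s : ℤ}
    (h : HitState x (c / 3 ^ n) (r / 3 ^ n) ((k + (j : ℝ) / 3) / 9 ^ n) N s)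
    (hs : s = gridIdx c r (peanoPos k - (j : ℝ) / 3) ∨
      s = gridIdx c r (peanoPos k - (j : ℝ) / 3) + 1) :
    ∃ (N' : ℕ) (s' : ℤ),
      HitState x (c / 3 ^ n) (r / 3 ^ n) ((k + ((j + 1 : ℕ) : ℝ) / 3) / 9 ^ n) N' s' ∧
      s' = min s (gridIdx c r (peanoPos k - ((j + 1 : ℕ) : ℝ) / 3) + 1) ∧
      (N' : ℤ) = N + (s - s') := by
  have hj' : (j : ℝ) ≤ 2 := by exact_mod_cast Nat.le_of_lt_succ hj
  have hk' : (k : ℝ) + 1 ≤ 9 ^ n := by exact_mod_cast hk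
  have h3 : (3 : ℝ) ^ n ≠ 0 := by positivity
  rw [← gridIdx_div h3] at hs
  rw [← gridIdx_div h3]
  refine h.down hx.continuousOn (by positivity) (by positivity) (by gcongr; simp)
    ?_ ?_ ?_ ?_ ?_ ?_ hs
  · push_cast
    rw [div_le_one (by positivity)]
    linarith
  · rw [hx.apply_scaled_third hk hj.le, if_neg hsgn, sub_eq_add_neg]
  · rw [hx.apply_scaled_third hk hj, if_neg hsgn, sub_eq_add_neg]
  · have := third_notMem_peanoGrid hG n (3 * peanoPos k - (j + 1 : ℕ))
    push_cast at this ⊢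
    rwa [sub_div, mul_div_cancel_left₀ _ (by norm_num : (3 : ℝ) ≠ 0)] at this
  · intro t ht
    obtain ⟨z, ⟨hz1, hz2⟩, hz⟩ := hx.mapsTo_scaled_third hk hj ht
    rw [hz, if_neg hsgn, ← sub_eq_add_neg]
    constructor <;> gcongr
  · rw [← add_div]
    refine div_le_div_of_nonneg_right ?_ (by positivity)
    push_cast
    linarith

/-- The index of the grid point visited last by the rescaled path before the integer time `k`. -/
def lastHit (c r : ℝ) (k : ℕ) : ℤ :=
  if peanoSgn (k - 1) = 1 then gridIdx c r (peanoPos k) else gridIdx c r (peanoPos k) + 1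

lemma HitState.unit_step {x : ℝ → ℝ} (hx : IsPeanoX x) {c r : ℝ} (hc : 1 / 3 ≤ c) (hc1 : c ≤ 1)
    (hG : ∀ z q : ℤ, (z : ℝ) / 3 ≠ c * q + r) {n k : ℕ} (hk : k < 9 ^ n) {N : ℕ}
    (h : HitState x (c / 3 ^ n) (r / 3 ^ n) (k / 9 ^ n) N (lastHit c r k)) :
    ∃ N' : ℕ, HitState x (c / 3 ^ n) (r / 3 ^ n) ((k + 1 : ℕ) / 9 ^ n) N' (lastHit c r (k + 1)) ∧
      (N' : ℤ) = N + |gridIdx c r (peanoPos (k + 1)) - gridIdx c r (peanoPos k)|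
        - peanoTurn k := by
  have hc0 : 0 < c := by linarith
  have hs : lastHit c r k = gridIdx c r (peanoPos k) ∨
      lastHit c r k = gridIdx c r (peanoPos k) + 1 := by
    unfold lastHit; split_ifs <;> simp
  have e0 : ((k : ℝ) + ((0 : ℕ) : ℝ) / 3) / 9 ^ n = k / 9 ^ n := by simp
  have e3 : ((k : ℝ) + ((2 + 1 : ℕ) : ℝ) / 3) / 9 ^ n = ((k + 1 : ℕ) : ℝ) / 9 ^ n := by
    push_cast; norm_num
  rw [← e0] at h
  by_cases hsgn : peanoSgn k = 1
  · have q0 : gridIdx c r (peanoPos k + ((0 : ℕ) : ℝ) / 3) = gridIdx c r (peanoPos k) := by simp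
    have q3 : gridIdx c r (peanoPos k + ((2 + 1 : ℕ) : ℝ) / 3) =
        gridIdx c r (peanoPos (k + 1)) := by
      rw [peanoPos_succ, hsgn]; congr 1; push_cast; norm_num
    have step : ∀ j : ℕ, gridIdx c r (peanoPos k + (j : ℝ) / 3) ≤
        gridIdx c r (peanoPos k + ((j + 1 : ℕ) : ℝ) / 3) ∧
        gridIdx c r (peanoPos k + ((j + 1 : ℕ) : ℝ) / 3) ≤
        gridIdx c r (peanoPos k + (j : ℝ) / 3) + 1 := fun j =>
      ⟨gridIdx_mono hc0 r (by gcongr; simp),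
        gridIdx_add_le hc0 (by push_cast; linarith)⟩
    have total : gridIdx c r (peanoPos k) + 1 ≤ gridIdx c r (peanoPos (k + 1)) :=
      le_gridIdx_add hc0 (by rw [peanoPos_succ, hsgn]; push_cast; linarith)
    obtain ⟨N1, s1, h1, hs1, hN1⟩ := h.third_up hx hc hG hk (by norm_num) hsgn (by rw [q0]; exact hs)
    have b0 := step 0
    have b1 := step 1
    have b2 := step 2
    rw [q0] at b0
    rw [q3] at b2
    simp only [Nat.reduceAdd, zero_add] at h1 hs1 b0 b1 b2 e3 q3
    obtain ⟨N2, s2, h2, hs2, hN2⟩ :=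
      h1.third_up (j := 1) hx hc hG hk (by norm_num) hsgn (by omega)
    simp only [Nat.reduceAdd] at h2 hs2
    obtain ⟨N3, s3, h3, hs3, hN3⟩ :=
      h2.third_up (j := 2) hx hc hG hk (by norm_num) hsgn (by omega)
    simp only [Nat.reduceAdd] at h3 hs3
    rw [q3] at hs3
    have hs3' : s3 = lastHit c r (k + 1) := by
      rw [lastHit, Nat.add_sub_cancel, if_pos hsgn]; omega
    rw [e3, hs3'] at h3
    refine ⟨N3, h3, ?_⟩
    rw [abs_of_nonneg (by omega)]
    unfold peanoTurn
    unfold lastHit at *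
    rcases peanoSgn_eq (k - 1) with hp | hp <;> simp [hp, hsgn] at * <;> omega
  · have hsgn' : peanoSgn k = -1 := (peanoSgn_eq k).resolve_left hsgn
    have q0 : gridIdx c r (peanoPos k - ((0 : ℕ) : ℝ) / 3) = gridIdx c r (peanoPos k) := by simp
    have q3 : gridIdx c r (peanoPos k - ((2 + 1 : ℕ) : ℝ) / 3) =
        gridIdx c r (peanoPos (k + 1)) := by
      rw [peanoPos_succ, hsgn']; congr 1; push_cast; norm_num; ring
    have step : ∀ j : ℕ, gridIdx c r (peanoPos k - ((j + 1 : ℕ) : ℝ) / 3) ≤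
        gridIdx c r (peanoPos k - (j : ℝ) / 3) ∧
        gridIdx c r (peanoPos k - (j : ℝ) / 3) ≤
        gridIdx c r (peanoPos k - ((j + 1 : ℕ) : ℝ) / 3) + 1 := fun j =>
      ⟨gridIdx_mono hc0 r (by gcongr; simp),
        gridIdx_add_le hc0 (by push_cast; linarith)⟩
    have total : gridIdx c r (peanoPos (k + 1)) + 1 ≤ gridIdx c r (peanoPos k) :=
      le_gridIdx_add hc0 (by rw [peanoPos_succ, hsgn']; push_cast; linarith)
    obtain ⟨N1, s1, h1, hs1, hN1⟩ :=
      h.third_down hx hc hG hk (by norm_num) hsgn (by rw [q0]; exact hs)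
    have b0 := step 0
    have b1 := step 1
    have b2 := step 2
    rw [q0] at b0
    rw [q3] at b2
    simp only [Nat.reduceAdd, zero_add] at h1 hs1 b0 b1 b2 e3 q3
    obtain ⟨N2, s2, h2, hs2, hN2⟩ :=
      h1.third_down (j := 1) hx hc hG hk (by norm_num) hsgn (by omega)
    simp only [Nat.reduceAdd] at h2 hs2
    obtain ⟨N3, s3, h3, hs3, hN3⟩ :=
      h2.third_down (j := 2) hx hc hG hk (by norm_num) hsgn (by omega)
    simp only [Nat.reduceAdd] at h3 hs3
    rw [q3] at hs3
    have hs3' : s3 = lastHit c r (k + 1) := by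
      rw [lastHit, Nat.add_sub_cancel, if_neg hsgn]; omega
    rw [e3, hs3'] at h3
    refine ⟨N3, h3, ?_⟩
    rw [abs_of_nonpos (by omega)]
    unfold peanoTurn
    unfold lastHit at *
    rcases peanoSgn_eq (k - 1) with hp | hp <;> simp [hp, hsgn'] at * <;> omega

lemma hitState_zero {x : ℝ → ℝ} (hx : IsPeanoX x) {c r : ℝ} (hc : 0 < c)
    (hG : ∀ z q : ℤ, (z : ℝ) / 3 ≠ c * q + r) (n : ℕ) :
    HitState x (c / 3 ^ n) (r / 3 ^ n) 0 0 (lastHit c r 0) := by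
  have h3 : (0 : ℝ) < 3 ^ n := by positivity
  have h0 : (0 : ℝ) ∉ peanoGrid (c / 3 ^ n) (r / 3 ^ n) := by
    simpa using third_notMem_peanoGrid hG n 0
  have hlast : lastHit c r 0 = gridIdx (c / 3 ^ n) (r / 3 ^ n) 0 := by
    have := gridIdx_div (c := c) (r := r) (z := 0) h3.ne'
    simp only [zero_div] at this
    simp [lastHit, peanoSgn_zero, peanoPos_zero, this]
  have hneg : c / 3 ^ n * lastHit c r 0 + r / 3 ^ n < 0 := by
    refine lt_of_le_of_ne ?_ fun h => h0 ⟨_, h.symm⟩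
    rw [hlast]
    exact (gridIdx_spec (by positivity)).1
  have hset : lebTime x (c / 3 ^ n) (r / 3 ^ n) 0 =
      sInf (Real.toEReal '' hitSet x (c / 3 ^ n) (r / 3 ^ n) 0 (lastHit c r 0)) := by
    rw [lebTime]
    congr 2
    ext t
    refine and_congr_right fun ht => (and_iff_left ?_).symm
    exact (hneg.trans_le (hx.mem_Icc ht).1).ne'
  refine ⟨⟨0, le_rfl, le_rfl, hset⟩, ?_, fun m hm => by omega, fun m hm => by simp at hm⟩
  rw [hset]
  refine lt_sInf_image (isCompact_hitSet hx.continuousOn (by positivity) _ le_rfl _) fun t ht => ?_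
  refine lt_of_le_of_ne ht.1.1 ?_
  rintro rfl
  exact h0 (hx.apply_zero ▸ ht.2.1)

/-- The number of partition times up to the time `K / 9 ^ n`. -/
lemma exists_hitState {x : ℝ → ℝ} (hx : IsPeanoX x) {c r : ℝ} (hc : 1 / 3 ≤ c) (hc1 : c ≤ 1)
    (hG : ∀ z q : ℤ, (z : ℝ) / 3 ≠ c * q + r) (n : ℕ) {K : ℕ} (hK : K ≤ 9 ^ n) :
    ∃ N : ℕ, HitState x (c / 3 ^ n) (r / 3 ^ n) (K / 9 ^ n) N (lastHit c r K) ∧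
      (N : ℤ) = posVar (fun z => gridIdx c r z) K - turnCount K := by
  induction K with
  | zero => exact ⟨0, by simpa using hitState_zero hx (by linarith) hG n, by simp [posVar, turnCount]⟩
  | succ K ih =>
    obtain ⟨N, hN, e⟩ := ih (by omega)
    obtain ⟨N', hN', e'⟩ := hN.unit_step hx hc hc1 hG (by omega)
    refine ⟨N', hN', ?_⟩
    rw [e', e]
    simp only [posVar, turnCount, Finset.sum_range_succ]
    ring

lemma abs_gridIdx_sub_le {c : ℝ} (r u w : ℝ) :
    |((gridIdx c r w - gridIdx c r u : ℤ) : ℝ) - (w - u) / c| ≤ 1 := by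
  have h1 := Int.floor_le ((u - r) / c)
  have h2 := Int.lt_floor_add_one ((u - r) / c)
  have h3 := Int.floor_le ((w - r) / c)
  have h4 := Int.lt_floor_add_one ((w - r) / c)
  have e : (w - u) / c = (w - r) / c - (u - r) / c := by ring
  unfold gridIdx
  rw [e, abs_le]
  push_cast
  constructor <;> linarith

lemma posVar_succ (f : ℤ → ℤ) (K : ℕ) :
    posVar f (K + 1) = posVar f K + |f (peanoPos (K + 1)) - f (peanoPos K)| :=
  Finset.sum_range_succ _ _

lemma turnCount_succ (K : ℕ) : turnCount (K + 1) = turnCount K + peanoTurn K :=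
  Finset.sum_range_succ _ _

lemma abs_hits_sub_le {c : ℝ} (hc : 0 < c) (r : ℝ) (n K : ℕ) (hK : K ≤ 9 ^ n) :
    |((posVar (fun z => gridIdx c r z) K - turnCount K : ℤ) : ℝ) - (1 / c - 3 / 4) * K| ≤
      24 * 3 ^ n := by
  have hf : Monotone fun z : ℤ => gridIdx c r z := fun a b h =>
    gridIdx_mono hc r (by exact_mod_cast h)
  have := abs_le_of_block_le (fun K => ((posVar (fun z => gridIdx c r z) K - turnCount K : ℤ) : ℝ)
    - (1 / c - 3 / 4) * K) 2 (by simp [posVar, turnCount]) ?_ n K hK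
  · linarith
  intro j i
  have hp := posVar_pow_mul hf j (i + 1)
  rw [posVar_succ, mul_add (3 ^ j : ℤ), ← posVar_pow_mul hf j i] at hp
  have ht := turnCount_pow_mul j (i + 1)
  rw [turnCount_succ] at ht
  have ht' := turnCount_pow_mul j i
  have hturn : (0 : ℤ) ≤ peanoTurn i ∧ peanoTurn i ≤ 1 := by
    unfold peanoTurn; split_ifs <;> simp
  obtain ⟨hturn0, hturn1⟩ := hturn
  have hD : |((|gridIdx c r ((3 ^ j * peanoPos (i + 1) : ℤ) : ℝ) -
      gridIdx c r ((3 ^ j * peanoPos i : ℤ) : ℝ)| : ℤ) : ℝ) - 3 ^ j / c| ≤ 1 := by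
    have h3 : (0 : ℤ) ≤ 3 ^ j := by positivity
    rw [peanoPos_succ]
    rcases peanoSgn_eq i with h | h <;> rw [h]
    · rw [abs_of_nonneg (sub_nonneg.2 (hf (by linarith)))]
      convert abs_gridIdx_sub_le (c := c) r _ _ using 3
      push_cast
      ring
    · rw [abs_sub_comm (gridIdx c r _), abs_of_nonneg (sub_nonneg.2 (hf (by linarith)))]
      convert abs_gridIdx_sub_le (c := c) r _ _ using 3
      push_cast
      ring
  generalize |gridIdx c r ((3 ^ j * peanoPos (i + 1) : ℤ) : ℝ) -
      gridIdx c r ((3 ^ j * peanoPos i : ℤ) : ℝ)| = D at hp hD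
  have hp' : ((posVar (fun z => gridIdx c r z) (9 ^ j * (i + 1)) : ℤ) : ℝ) =
      posVar (fun z => gridIdx c r z) (9 ^ j * i) + 3 ^ j * D := by exact_mod_cast hp
  have htr : 4 * (turnCount (9 ^ j * (i + 1)) : ℝ) =
      3 * (9 ^ j - 1) * (i + 1) + 4 * (turnCount i + peanoTurn i) := by exact_mod_cast ht
  have htr' : 4 * (turnCount (9 ^ j * i) : ℝ) =
      3 * (9 ^ j - 1) * i + 4 * turnCount i := by exact_mod_cast ht'
  have hturn0' : (0 : ℝ) ≤ peanoTurn i := by exact_mod_cast hturn0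
  have hturn1' : (peanoTurn i : ℝ) ≤ 1 := by exact_mod_cast hturn1
  have h3 : (1 : ℝ) ≤ 3 ^ j := one_le_pow₀ (by norm_num)
  have h9 : (9 : ℝ) ^ j = 3 ^ j * 3 ^ j := by rw [← mul_pow]; norm_num
  have key : ((posVar (fun z => gridIdx c r z) (9 ^ j * (i + 1)) -
        turnCount (9 ^ j * (i + 1)) : ℤ) : ℝ) - (1 / c - 3 / 4) * ((9 ^ j * (i + 1) : ℕ) : ℝ) -
      (((posVar (fun z => gridIdx c r z) (9 ^ j * i) - turnCount (9 ^ j * i) : ℤ) : ℝ) -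
        (1 / c - 3 / 4) * ((9 ^ j * i : ℕ) : ℝ)) =
      3 ^ j * (D - 3 ^ j / c) + (3 / 4 - peanoTurn i) := by
    push_cast
    rw [hp']
    linear_combination (-1 / 4) * htr + (1 / 4) * htr' - 1 / c * h9
  rw [key]
  refine (abs_add_le _ _).trans ?_
  rw [abs_mul, abs_of_nonneg (by positivity : (0 : ℝ) ≤ 3 ^ j)]
  have h1 : (3 : ℝ) ^ j * |(D : ℝ) - 3 ^ j / c| ≤ 3 ^ j * 1 := by gcongr
  have h2 : |(3 / 4 : ℝ) - peanoTurn i| ≤ 1 := by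
    rw [abs_le]; constructor <;> linarith
  linarith

/-- The limit for grids of mesh `c / 3 ^ n` with `1/3 ≤ c ≤ 1` avoiding the ternary rationals. -/
lemma tendsto_qvar0_scaled {x : ℝ → ℝ} (hx : IsPeanoX x) {c r : ℝ} (hc : 1 / 3 ≤ c)
    (hc1 : c ≤ 1) (hG : ∀ z q : ℤ, (z : ℝ) / 3 ≠ c * q + r) {t : ℝ}
    (ht : t ∈ Set.Icc (0 : ℝ) 1) :
    Tendsto (fun n : ℕ => qvar0 x (c / 3 ^ n) (r / 3 ^ n) t) atTop
      (nhds (c * (1 - 3 / 4 * c) * t)) := by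
  have hc0 : 0 < c := by linarith
  set μ : ℝ := 1 / c - 3 / 4 with hμ
  have hμ0 : 0 ≤ μ := by
    have : 1 ≤ 1 / c := by rw [le_div_iff₀ hc0]; linarith
    linarith
  rw [tendsto_iff_norm_sub_tendsto_zero]
  have hlim : Tendsto (fun n : ℕ => c ^ 2 * (25 + μ) * (1 / 3 : ℝ) ^ n) atTop (nhds 0) := by
    simpa using (tendsto_pow_atTop_nhds_zero_of_lt_one (by norm_num : (0 : ℝ) ≤ 1 / 3)
      (by norm_num)).const_mul (c ^ 2 * (25 + μ))
  refine squeeze_zero (fun n => norm_nonneg _) (fun n => ?_) hlim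
  have h9 : (0 : ℝ) < 9 ^ n := by positivity
  have h0 : 0 ≤ t * 9 ^ n := mul_nonneg ht.1 h9.le
  have hk2 : ⌈t * 9 ^ n⌉₊ ≤ 9 ^ n := by
    rw [Nat.ceil_le]; push_cast; exact mul_le_of_le_one_left h9.le ht.2
  have hk1 : ⌊t * 9 ^ n⌋₊ ≤ 9 ^ n := (Nat.floor_le_ceil _).trans hk2
  obtain ⟨N, hN, eN⟩ := exists_hitState hx hc hc1 hG n hk1
  obtain ⟨M, hM, eM⟩ := exists_hitState hx hc hc1 hG n hk2
  obtain ⟨L, hNL, hLM, hL⟩ := hN.exists_qvar0_eq hM (t := t)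
    (by rw [div_le_iff₀ h9]; exact Nat.floor_le h0)
    (by rw [le_div_iff₀ h9]; exact Nat.le_ceil _)
  have bN := abs_hits_sub_le hc0 r n _ hk1
  have bM := abs_hits_sub_le hc0 r n _ hk2
  rw [← eN, ← hμ, abs_le] at bN
  rw [← eM, ← hμ, abs_le] at bM
  have f1 : μ * (t * 9 ^ n) ≤ μ * (⌊t * 9 ^ n⌋₊ + 1) :=
    mul_le_mul_of_nonneg_left (Nat.lt_floor_add_one _).le hμ0
  have f2 : μ * ⌈t * 9 ^ n⌉₊ ≤ μ * (t * 9 ^ n + 1) :=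
    mul_le_mul_of_nonneg_left (Nat.ceil_lt_add_one h0).le hμ0
  have g1 : (N : ℝ) ≤ (L - 1 : ℕ) + 1 := by
    have : N ≤ (L - 1) + 1 := by omega
    exact_mod_cast this
  have g2 : ((L - 1 : ℕ) : ℝ) ≤ M := by
    have : L - 1 ≤ M := by omega
    exact_mod_cast this
  have h3 : (1 : ℝ) ≤ 3 ^ n := one_le_pow₀ (by norm_num)
  have h3μ : μ * 1 ≤ μ * 3 ^ n := mul_le_mul_of_nonneg_left h3 hμ0
  have key : |((L - 1 : ℕ) : ℝ) - μ * (t * 9 ^ n)| ≤ (25 + μ) * 3 ^ n := by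
    have b1 := bN.1
    have b2 := bM.2
    push_cast at b1 b2
    rw [abs_le]
    constructor <;> linarith
  have e93 : (9 : ℝ) ^ n = 3 ^ n * 3 ^ n := by rw [← mul_pow]; norm_num
  have e : qvar0 x (c / 3 ^ n) (r / 3 ^ n) t - c * (1 - 3 / 4 * c) * t =
      c ^ 2 / 9 ^ n * (((L - 1 : ℕ) : ℝ) - μ * (t * 9 ^ n)) := by
    rw [hL, hμ, div_pow, ← pow_mul, mul_comm n 2, pow_mul]
    norm_num
    field_simp
  rw [e, Real.norm_eq_abs, abs_mul, abs_of_nonneg (by positivity : 0 ≤ c ^ 2 / 9 ^ n)]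
  calc c ^ 2 / 9 ^ n * |((L - 1 : ℕ) : ℝ) - μ * (t * 9 ^ n)|
      ≤ c ^ 2 / 9 ^ n * ((25 + μ) * 3 ^ n) := by gcongr
    _ = c ^ 2 * (25 + μ) * (1 / 3 : ℝ) ^ n := by
      rw [e93, one_div_pow]; field_simp

/-- The quadratic variations of the horizontal component of the Peano curve along the
Lebesgue partitions for the grids `3^{-n}p ℤ + 3^{-n}r` converge to
`3^⌊-log₃ p⌋ p (1 - (3/4) 3^⌊-log₃ p⌋ p) t`. -/
theorem peano_qvar_limit (x : ℝ → ℝ) (hx : IsPeanoX x)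
    (p' q' : ℕ) (hp'pos : 0 < p') (hq'pos : 0 < q')
    (hp'3 : ¬ (3 ∣ p')) (hq'3 : ¬ (3 ∣ q'))
    (p : ℝ) (hp : p = (p' : ℝ) / (q' : ℝ))
    (θ r : ℝ) (hθ : ∀ m : ℤ, ∀ a : ℤ, θ ≠ (a : ℝ) * ((3 : ℝ) ^ m / (p' : ℝ)))
    (hr : r = θ * p)
    (t : ℝ) (ht : t ∈ Set.Icc (0 : ℝ) 1) :
    Filter.Tendsto (fun n : ℕ => qvar0 x (p / 3 ^ n) (r / 3 ^ n) t) Filter.atTop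
      (nhds ((3 : ℝ) ^ (⌊-Real.logb 3 p⌋) * p *
        (1 - 3 / 4 * ((3 : ℝ) ^ (⌊-Real.logb 3 p⌋) * p)) * t)) := by
  have hp0 : 0 < p := by rw [hp]; positivity
  have hp'0 : (p' : ℝ) ≠ 0 := by exact_mod_cast hp'pos.ne'
  have hq'0 : (q' : ℝ) ≠ 0 := by exact_mod_cast hq'pos.ne'
  set f : ℤ := ⌊-Real.logb 3 p⌋ with hf
  have h3f : (0 : ℝ) < 3 ^ f := by positivity
  have hpow : (3 : ℝ) ^ (-Real.logb 3 p) = p⁻¹ := by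
    rw [Real.rpow_neg (by norm_num), Real.rpow_logb (by norm_num) (by norm_num) hp0]
  have hc1 : (3 : ℝ) ^ f * p ≤ 1 := by
    have h : (3 : ℝ) ^ f ≤ p⁻¹ := by
      rw [← hpow, ← Real.rpow_intCast]
      exact Real.rpow_le_rpow_of_exponent_le (by norm_num) (Int.floor_le _)
    calc (3 : ℝ) ^ f * p ≤ p⁻¹ * p := by gcongr
      _ = 1 := inv_mul_cancel₀ hp0.ne'
  have hc : 1 / 3 ≤ (3 : ℝ) ^ f * p := by
    have h : p⁻¹ ≤ (3 : ℝ) ^ (f + 1) := by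
      rw [← hpow, ← Real.rpow_intCast]
      refine Real.rpow_le_rpow_of_exponent_le (by norm_num) ?_
      push_cast
      exact (Int.lt_floor_add_one _).le
    rw [zpow_add_one₀ (by norm_num), inv_le_iff_one_le_mul₀ hp0] at h
    linarith
  have hG : ∀ z q : ℤ, (z : ℝ) / 3 ≠ (3 : ℝ) ^ f * p * q + (3 : ℝ) ^ f * r := by
    intro z q hzq
    have hθ' : θ = (z * q' * (3 : ℝ) ^ (-(f + 1)) - q * p') / p' := by
      rw [hr, hp] at hzq
      rw [zpow_neg, zpow_add_one₀ (by norm_num)]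
      field_simp at hzq ⊢
      linear_combination -hzq
    rcases le_total 0 (f + 1) with h | h
    · obtain ⟨e, he⟩ := Int.eq_ofNat_of_zero_le h
      refine hθ (-(f + 1)) (z * q' - q * p' * 3 ^ e) ?_
      rw [hθ', he, zpow_neg, zpow_natCast]
      push_cast
      field_simp
    · obtain ⟨e, he⟩ := Int.eq_ofNat_of_zero_le (show 0 ≤ -(f + 1) by omega)
      refine hθ 0 (z * q' * 3 ^ e - q * p') ?_
      rw [hθ', he, zpow_natCast]
      push_cast
      ring
  have hidx : Tendsto (fun n : ℕ => ((n : ℤ) + f).toNat) atTop atTop := by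
    refine tendsto_atTop.2 fun b => ?_
    filter_upwards [eventually_ge_atTop (b + f.natAbs)] with n hn
    omega
  refine ((tendsto_qvar0_scaled hx hc hc1 hG ht).comp hidx).congr' ?_
  filter_upwards [eventually_ge_atTop f.natAbs] with n hn
  have hN : (3 : ℝ) ^ ((n : ℤ) + f).toNat = 3 ^ n * 3 ^ f := by
    rw [← zpow_natCast, Int.toNat_of_nonneg (by omega), zpow_add₀ (by norm_num), zpow_natCast]
  simp only [Function.comp_apply]
  rw [hN, mul_comm ((3 : ℝ) ^ n), mul_div_mul_left _ _ h3f.ne', mul_div_mul_left _ _ h3f.ne']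
end
end

section
/- The horizontal component x of the Peano curve satisfies the symmetry x(1-t) = 1 - x(t) for all t ∈ [0,1]. -/
open scoped BigOperators Classical
open Filter

noncomputable section

theorem hasSum_two_div_three_pow_succ : HasSum (fun j : ℕ => (2 : ℝ) / 3 ^ (j + 1)) 1 := by
  have h := (hasSum_geometric_of_lt_one (r := (1 / 3 : ℝ)) (by norm_num) (by norm_num)).mul_left
    (2 / 3)
  have hterm (j : ℕ) : (2 : ℝ) / 3 * (1 / 3) ^ j = 2 / 3 ^ (j + 1) := by
    rw [one_div_pow, pow_succ]
    field_simp
  simp only [hterm] at h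
  rwa [show (2 : ℝ) / 3 * (1 - 1 / 3)⁻¹ = 1 by norm_num] at h

/-- Reflecting every ternary digit reflects the number about `1 / 2`. -/
theorem tsum_reflected_ternary {a b : ℕ → ℕ} (hab : ∀ j, a j + b j = 2) :
    ∑' j, (b j : ℝ) / 3 ^ (j + 1) = 1 - ∑' j, (a j : ℝ) / 3 ^ (j + 1) := by
  have ha : Summable fun j => (a j : ℝ) / 3 ^ (j + 1) := by
    refine Summable.of_nonneg_of_le (fun j => by positivity) (fun j => ?_)
      hasSum_two_div_three_pow_succ.summable
    gcongr
    exact_mod_cast Nat.le.intro (hab j)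
  rw [← (hasSum_two_div_three_pow_succ.sub ha.hasSum).tsum_eq]
  refine tsum_congr fun j => ?_
  have h : (a j : ℝ) + b j = 2 := by exact_mod_cast hab j
  rw [← h]
  ring

theorem peanoK_iterate {a : ℕ} (ha : a ≤ 2) (n : ℕ) :
    peanoK^[n] a = if Even n then a else 2 - a := by
  induction n with
  | zero => simp
  | succ n ih =>
    rw [Function.iterate_succ_apply', ih]
    by_cases h : Even n <;> simp [h, Nat.even_add_one, peanoK]; omega

theorem even_sum_rev_iff (d : ℕ → Fin 3) (s : Finset ℕ) :
    Even (∑ i ∈ s, ((d i).rev : ℕ)) ↔ Even (∑ i ∈ s, (d i : ℕ)) := by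
  rw [← Nat.even_add, ← Finset.sum_add_distrib]
  refine Finset.even_sum _ fun i _ => ⟨1, ?_⟩
  rw [Fin.val_rev]
  omega

theorem peanoXDigit_add_rev (d : ℕ → Fin 3) (m : ℕ) :
    peanoXDigit d m + peanoXDigit (fun j => (d j).rev) m = 2 := by
  have h := even_sum_rev_iff (fun i => d (2 * i + 1)) (Finset.range m)
  unfold peanoXDigit
  rw [peanoK_iterate (by omega), peanoK_iterate (by omega), if_congr h rfl rfl, Fin.val_rev]
  split_ifs <;> omega

theorem exists_ternary_expansion {t : ℝ} (ht : t ∈ Set.Icc (0 : ℝ) 1) :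
    ∃ d : ℕ → Fin 3, ∑' j, (d j : ℝ) / 3 ^ (j + 1) = t := by
  obtain ⟨d, -, hd⟩ := Real.ofDigits_SurjOn (b := 3) (by norm_num) ht
  exact ⟨d, by simpa [Real.ofDigits, Real.ofDigitsTerm, div_eq_mul_inv] using hd⟩

/-- The symmetry `x(1-t) = 1 - x(t)` of the horizontal component of the Peano curve. -/
theorem peano_symmetry (x : ℝ → ℝ) (hx : IsPeanoX x) :
    ∀ t ∈ Set.Icc (0 : ℝ) 1, x (1 - t) = 1 - x t := by
  intro t ht
  obtain ⟨d, rfl⟩ := exists_ternary_expansion ht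
  rw [← tsum_reflected_ternary (b := fun j => (d j).rev) fun j => by rw [Fin.val_rev]; omega,
    hx d, hx fun j => (d j).rev]
  exact tsum_reflected_ternary (peanoXDigit_add_rev d)
end
end
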